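/- arXiv:0902.3045 — 3 statements merged into one kernel-verified Lean document; each statement's English description precedes it below -/
import Mathlib

section
/- Let M, N be subspaces of a Banach space with gap δ(M, N) < 1. If M is finite-dimensional, then dim M ≤ dim N. -/
/-- The gap `δ(M, P) = sup { dist(x, P) : x ∈ M, ‖x‖ = 1 }` between subspaces. -/
noncomputable def subspaceGap {X : Type*} [NormedAddCommGroup X] [NormedSpace ℝ X]
    (M P : Submodule ℝ X) : ℝ :=
  sSup {d : ℝ | ∃ x ∈ M, ‖x‖ = 1 ∧ d = Metric.infDist x (P : Set X)}

/-! ### Mod 2 chains on lists of points -/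

namespace GapBU

abbrev Ch (V : Type*) := List V →₀ ZMod 2

noncomputable section

variable {V : Type*}

def lst (l : List V) : Ch V := Finsupp.single l 1

def cone (v : V) : Ch V →ₗ[ZMod 2] Ch V := Finsupp.lmapDomain _ _ (List.cons v)

def bdL : List V → Ch V
  | [] => 0
  | v :: l => lst l + cone v (bdL l)

def bd : Ch V →ₗ[ZMod 2] Ch V := Finsupp.linearCombination (ZMod 2) bdL

def ev (f : List V → ZMod 2) : Ch V →ₗ[ZMod 2] ZMod 2 := Finsupp.linearCombination (ZMod 2) f

def Sp (P : List V → Prop) : Submodule (ZMod 2) (Ch V) :=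
  Submodule.span (ZMod 2) (lst '' {l | P l})

@[simp] lemma cone_lst (v : V) (l : List V) : cone v (lst l) = lst (v :: l) := by
  simp [cone, lst]

@[simp] lemma bd_lst (l : List V) : bd (lst l) = bdL l := by
  simp [bd, lst]

@[simp] lemma ev_lst (f : List V → ZMod 2) (l : List V) : ev f (lst l) = f l := by
  simp [ev, lst]

lemma lst_mem {P : List V → Prop} {l : List V} (h : P l) : lst l ∈ Sp P :=
  Submodule.subset_span ⟨l, h, rfl⟩

lemma Sp_map {W : Type*} [AddCommGroup W] [Module (ZMod 2) W] {P : List V → Prop}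
    (T : Ch V →ₗ[ZMod 2] W) (Q : Submodule (ZMod 2) W)
    (h : ∀ l, P l → T (lst l) ∈ Q) {c : Ch V} (hc : c ∈ Sp P) : T c ∈ Q := by
  have : Sp P ≤ Q.comap T := by
    refine Submodule.span_le.2 ?_
    rintro _ ⟨l, hl, rfl⟩
    exact h l hl
  exact this hc

lemma Sp_eq {W : Type*} [AddCommGroup W] [Module (ZMod 2) W] {P : List V → Prop}
    (T T' : Ch V →ₗ[ZMod 2] W)
    (h : ∀ l, P l → T (lst l) = T' (lst l)) {c : Ch V} (hc : c ∈ Sp P) : T c = T' c := by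
  have := Sp_map (P := P) (T - T') ⊥ (fun l hl => by simp [h l hl]) hc
  simpa [sub_eq_zero] using this

lemma Sp_comm {W : Type*} [AddCommGroup W] [Module (ZMod 2) W] {P : List V → Prop}
    {U U' : Type*} [AddCommGroup U] [Module (ZMod 2) U] [AddCommGroup U'] [Module (ZMod 2) U']
    (T : U →ₗ[ZMod 2] W) (T' : Ch V →ₗ[ZMod 2] U) (R : U' →ₗ[ZMod 2] W) (R' : Ch V →ₗ[ZMod 2] U')
    (h : ∀ l, P l → T (T' (lst l)) = R (R' (lst l))) {c : Ch V} (hc : c ∈ Sp P) :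
    T (T' c) = R (R' c) := by
  have := Sp_eq (T.comp T') (R.comp R') (by intro l hl; simpa using h l hl) hc
  simpa using this

lemma Sp_mono {P Q : List V → Prop} (h : ∀ l, P l → Q l) : Sp P ≤ Sp Q := by
  refine Submodule.span_mono ?_
  exact Set.image_mono h

lemma Sp_top (c : Ch V) : c ∈ Sp (fun _ => True) := by
  induction c using Finsupp.induction_linear with
  | zero => exact zero_mem _
  | add f g hf hg => exact add_mem hf hg
  | single a b =>
    have : Finsupp.single a b = b • lst a := by simp [lst]
    rw [this]
    exact Submodule.smul_mem _ _ (lst_mem trivial)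

lemma ch_add_self (c : Ch V) : c + c = 0 := by
  ext l
  simpa using CharTwo.add_self_eq_zero (c l)

lemma bd_cone (v : V) (c : Ch V) : bd (cone v c) = c + cone v (bd c) :=
  Sp_eq (bd ∘ₗ cone v) (LinearMap.id + cone v ∘ₗ bd) (fun l _ => by simp [bdL]) (Sp_top c)

lemma bd_bdL (l : List V) : bd (bdL l) = 0 := by
  induction l with
  | nil => simp [bdL]
  | cons v l ih => simp [bdL, bd_cone, ih, ch_add_self]

lemma bd_bd (c : Ch V) : bd (bd c) = 0 :=
  Sp_eq (bd ∘ₗ bd) 0 (fun l _ => by simp [bd_bdL]) (Sp_top c)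

lemma bdL_mem (l : List V) :
    bdL l ∈ Sp (fun l' => l'.length + 1 = l.length ∧ ∀ v ∈ l', v ∈ l) := by
  induction l with
  | nil => exact zero_mem _
  | cons v l ih =>
    refine add_mem (lst_mem ⟨by simp, fun u hu => by simp [hu]⟩) ?_
    refine Sp_map (cone v) _ ?_ ih
    rintro l' ⟨h1, h2⟩
    rw [cone_lst]
    refine lst_mem ⟨by simp [h1], ?_⟩
    intro u hu
    rcases List.mem_cons.1 hu with rfl | hu
    · simp
    · simp [h2 u hu]

/-! ### The cocycles -/

def Wc : List (V → ZMod 2) → List V → ZMod 2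
  | [], _ => 1
  | s :: ss, v :: u :: l => (s v + s u) * Wc ss (u :: l)
  | _ :: _, _ => 0

def al (s : V → ZMod 2) (ss : List (V → ZMod 2)) : List V → ZMod 2
  | [] => 0
  | v :: l => s v * Wc ss (v :: l)

lemma ev_al_cone (s : V → ZMod 2) (ss : List (V → ZMod 2)) (v : V) (c : Ch V) :
    ev (al s ss) (cone v c) = s v * ev (Wc ss) (cone v c) :=
  Sp_eq (ev (al s ss) ∘ₗ cone v) (s v • (ev (Wc ss) ∘ₗ cone v))
    (fun l _ => by simp [al]) (Sp_top c)

lemma al_bd_of (s : V → ZMod 2) (ss : List (V → ZMod 2))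
    (hW : ∀ l : List V, l.length = ss.length + 2 → ev (Wc ss) (bdL l) = 0)
    (l : List V) (hl : l.length = ss.length + 2) :
    ev (al s ss) (bdL l) = Wc (s :: ss) l := by
  match l, hl with
  | v :: u :: l, hl =>
    have h := hW (v :: u :: l) hl
    rw [bdL, map_add, ev_lst] at h
    rw [bdL, map_add, ev_lst, ev_al_cone, al, Wc]
    have h2 : ev (Wc ss) (cone v (bdL (u :: l))) = Wc ss (u :: l) := by
      have := eq_neg_of_add_eq_zero_right h
      rw [this]; exact CharTwo.neg_eq _
    rw [h2]; ring

lemma W_cocycle (ss : List (V → ZMod 2)) :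
    ∀ l : List V, l.length = ss.length + 2 → ev (Wc ss) (bdL l) = 0 := by
  induction ss with
  | nil =>
    intro l hl
    match l, hl with
    | [v, u], _ =>
      simp [bdL, Wc]
      decide
  | cons s ss ih =>
    intro l hl
    have h1 : ev (Wc (s :: ss)) (bdL l) = ev (al s ss) (bd (bdL l)) := by
      refine Sp_eq (ev (Wc (s :: ss))) (ev (al s ss) ∘ₗ bd) ?_ (bdL_mem l)
      rintro l' ⟨h1, -⟩
      simp only [LinearMap.comp_apply, ev_lst, bd_lst]
      rw [al_bd_of s ss ih l' (by simp at hl; omega)]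
    rw [h1, bd_bdL, map_zero]

lemma W_zero (ss : List (V → ZMod 2)) : ∀ l : List V, l.length = ss.length + 1 →
    (∃ s ∈ ss, ∀ v ∈ l, ∀ u ∈ l, s v = s u) → Wc ss l = 0 := by
  induction ss with
  | nil => rintro l - ⟨s, hs, -⟩; simp at hs
  | cons s ss ih =>
    intro l hl h
    match l, hl with
    | v :: u :: l, hl =>
      obtain ⟨t, ht, h⟩ := h
      rw [Wc]
      rcases List.mem_cons.1 ht with rfl | ht
      · rw [h v (by simp) u (by simp), CharTwo.add_self_eq_zero, zero_mul]
      · rw [ih (u :: l) (by simpa using hl) ⟨t, ht, fun a ha b hb =>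
          h a (List.mem_cons_of_mem _ ha) b (List.mem_cons_of_mem _ hb)⟩, mul_zero]

/-! ### Antipode -/

section anti
variable [AddCommGroup V]

def ant : Ch V →ₗ[ZMod 2] Ch V := Finsupp.lmapDomain _ _ (List.map Neg.neg)

@[simp] lemma ant_lst (l : List V) : ant (lst l) = lst (l.map Neg.neg) := by
  simp [ant, lst]

lemma ant_cone (v : V) (c : Ch V) : ant (cone v c) = cone (-v) (ant c) :=
  Sp_comm ant (cone v) (cone (-v)) ant (fun l _ => by simp) (Sp_top c)

lemma bdL_ant (l : List V) : bdL (l.map Neg.neg) = ant (bdL l) := by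
  induction l with
  | nil => simp [bdL]
  | cons v l ih => simp [bdL, ih, ant_cone]

lemma bd_ant (c : Ch V) : bd (ant c) = ant (bd c) :=
  Sp_comm bd ant ant bd (fun l _ => by simp [bdL_ant]) (Sp_top c)

lemma ant_ant (c : Ch V) : ant (ant c) = c :=
  Sp_eq (ant ∘ₗ ant) LinearMap.id (fun l _ => by simp) (Sp_top c)

lemma W_ant (ss : List (V → ZMod 2)) (hss : ∀ s ∈ ss, ∀ v ≠ 0, s v + s (-v) = 1) :
    ∀ l : List V, (∀ v ∈ l, v ≠ 0) → Wc ss (l.map Neg.neg) = Wc ss l := by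
  induction ss with
  | nil => intro l _; simp [Wc]
  | cons s ss ih =>
    intro l hl
    match l with
    | [] => simp [Wc]
    | [v] => simp [Wc]
    | v :: u :: l =>
      have h := ih (fun t ht => hss t (by simp [ht])) (u :: l)
        (fun a ha => hl a (List.mem_cons_of_mem _ ha))
      simp only [List.map_cons] at h ⊢
      rw [Wc, Wc, h]
      have h1 := hss s (by simp) v (hl v (by simp))
      have h2 := hss s (by simp) u (hl u (by simp))
      congr 1
      generalize s v = a at *
      generalize s u = b at *
      generalize s (-v) = a' at *
      generalize s (-u) = b' at *
      revert a b a' b'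
      decide

/-- The key combinatorial identity. -/
lemma W_chain (c : ℕ → Ch V) (n : ℕ)
    (hsp : ∀ k ≤ n, c k ∈ Sp (fun l => l.length = k + 1 ∧ ∀ v ∈ l, v ≠ 0))
    (h0 : ev (fun _ => 1) (c 0) = 1)
    (hb : ∀ k < n, bd (c (k + 1)) = c k + ant (c k))
    (ss : List (V → ZMod 2)) (hss : ∀ s ∈ ss, ∀ v ≠ 0, s v + s (-v) = 1)
    (hn : ss.length ≤ n) : ev (Wc ss) (c ss.length) = 1 := by
  induction ss with
  | nil =>
    have : Wc ([] : List (V → ZMod 2)) = fun _ => 1 := by funext l; simp [Wc]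
    rw [this]; exact h0
  | cons s ss ih =>
    simp only [List.length_cons] at hn ⊢
    have ih := ih (fun t ht => hss t (by simp [ht])) (by omega)
    have h1 : ev (Wc (s :: ss)) (c (ss.length + 1)) = ev (al s ss) (bd (c (ss.length + 1))) := by
      refine Sp_eq (ev (Wc (s :: ss))) (ev (al s ss) ∘ₗ bd) ?_ (hsp _ hn)
      rintro l' ⟨h1, -⟩
      simp only [LinearMap.comp_apply, ev_lst, bd_lst]
      rw [al_bd_of s ss (W_cocycle ss) l' (by omega)]
    rw [h1, hb _ (by omega), ← ih]
    refine Sp_eq (ev (al s ss) ∘ₗ (LinearMap.id + ant)) (ev (Wc ss)) ?_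
      (hsp ss.length (by omega))
    rintro l ⟨hl, hl0⟩
    match l, hl with
    | v :: l, hl =>
      have hw := W_ant ss (fun t ht => hss t (by simp [ht])) (v :: l) hl0
      simp only [LinearMap.comp_apply, LinearMap.add_apply, LinearMap.id_apply, map_add, ev_lst,
        ant_lst, al, List.map_cons] at hw ⊢
      rw [hw, ← add_mul, hss s (by simp) v (hl0 v (by simp)), one_mul]

end anti

/-! ### Subdivision -/

section sub
variable [NormedAddCommGroup V] [NormedSpace ℝ V]

def bary (l : List V) : V := (l.length : ℝ)⁻¹ • l.sum

def sd : ℕ → (Ch V →ₗ[ZMod 2] Ch V)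
  | 0 => LinearMap.id
  | k + 1 => Finsupp.linearCombination (ZMod 2) (fun l => cone (bary l) (sd k (bdL l)))

lemma sd_lst (k : ℕ) (l : List V) : sd (k + 1) (lst l) = cone (bary l) (sd k (bdL l)) := by
  simp [sd, lst]

lemma bary_neg (l : List V) : bary (l.map Neg.neg) = - bary l := by
  have : (l.map Neg.neg).sum = - l.sum := by
    induction l with
    | nil => simp
    | cons v l ih => simp [ih, add_comm]
  simp [bary, this]

lemma sd_ant (k : ℕ) : ∀ c : Ch V, sd k (ant c) = ant (sd k c) := by
  induction k with
  | zero => intro c; simp [sd]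
  | succ k ih =>
    intro c
    refine Sp_comm (sd (k+1)) ant ant (sd (k+1)) (fun l _ => ?_) (Sp_top c)
    simp only [ant_lst, sd_lst, ant_cone, bary_neg, bdL_ant, ih]

lemma bd_sd_lst (k : ℕ) : ∀ l : List V, l.length = k + 1 →
    bd (sd (k + 1) (lst l)) = sd k (bdL l) := by
  induction k with
  | zero =>
    intro l hl
    match l, hl with
    | [v], _ =>
      rw [sd_lst, bd_cone]
      simp [sd, bdL]
  | succ k ih =>
    intro l hl
    rw [sd_lst, bd_cone]
    have : bd (sd (k + 1) (bdL l)) = sd k (bd (bdL l)) := by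
      refine Sp_comm bd (sd (k + 1)) (sd k) bd ?_ (bdL_mem l)
      rintro l' ⟨h, -⟩
      simp only [bd_lst]
      exact ih l' (by omega)
    rw [this, bd_bdL, map_zero, map_zero, add_zero]

lemma norm_sum_sub_le (l : List V) (v : V) (D : ℝ) (h : ∀ u ∈ l, ‖u - v‖ ≤ D) :
    ‖l.sum - (l.length : ℝ) • v‖ ≤ l.length * D := by
  induction l with
  | nil => simp
  | cons u l ih =>
    have h1 := ih (fun a ha => h a (by simp [ha]))
    have h2 := h u (by simp)
    have : (u :: l).sum - ((u :: l).length : ℝ) • v = (u - v) + (l.sum - (l.length : ℝ) • v) := by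
      simp only [List.sum_cons, List.length_cons, Nat.cast_add, Nat.cast_one, add_smul, one_smul]
      abel
    rw [this]
    refine (norm_add_le _ _).trans ?_
    simp only [List.length_cons, Nat.cast_add, Nat.cast_one]
    linarith

lemma bary_dist (l : List V) (k : ℕ) (hl : l.length = k + 1) (D : ℝ)
    (h : ∀ v ∈ l, ∀ u ∈ l, ‖v - u‖ ≤ D) (v : V) (hv : v ∈ l) :
    ‖v - bary l‖ ≤ k / (k + 1) * D := by
  classical
  have hp := List.perm_cons_erase hv
  have hs : l.sum = v + (l.erase v).sum := by rw [hp.sum_eq, List.sum_cons]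
  have hlen : (l.erase v).length = k := by
    rw [List.length_erase_of_mem hv, hl]; rfl
  have h1 := norm_sum_sub_le (l.erase v) v D (fun u hu => h u (List.mem_of_mem_erase hu) v hv)
  have hk : (k : ℝ) + 1 ≠ 0 := by positivity
  have : v - bary l = - (((k : ℝ) + 1)⁻¹ • ((l.erase v).sum - (k : ℝ) • v)) := by
    rw [bary, hl, hs]
    push_cast
    have : v = ((k : ℝ) + 1)⁻¹ • (((k : ℝ) + 1) • v) := by rw [inv_smul_smul₀ hk]
    nth_rw 1 [this]
    rw [← smul_sub, ← smul_neg]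
    congr 1
    rw [add_smul, one_smul]; abel
  rw [this, norm_neg, norm_smul, norm_inv, Real.norm_of_nonneg (by positivity)]
  rw [hlen] at h1
  calc ((k : ℝ) + 1)⁻¹ * _ ≤ ((k : ℝ) + 1)⁻¹ * (k * D) := by gcongr
    _ = _ := by ring

lemma bary_mem (l : List V) (hl : l ≠ []) (C : Set V) (hC : Convex ℝ C) (h : ∀ v ∈ l, v ∈ C) :
    bary l ∈ C := by
  have key : ∀ l : List V, (∀ v ∈ l, v ∈ C) → l ≠ [] → bary l ∈ C := by
    intro l
    induction l with
    | nil => intro _ h; exact absurd rfl h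
    | cons v l ih =>
      intro h _
      by_cases hl : l = []
      · subst hl; simpa [bary] using h
      · have h1 := ih (fun a ha => h a (by simp [ha])) hl
        have hpos : (0 : ℝ) < l.length := by
          exact_mod_cast List.length_pos_iff.2 hl
        have := hC (h v (by simp)) h1 (a := ((l.length : ℝ) + 1)⁻¹)
          (b := l.length * ((l.length : ℝ) + 1)⁻¹) (by positivity) (by positivity)
          (by field_simp; ring)
        convert this using 1
        simp only [bary, List.length_cons, List.sum_cons, smul_add, smul_smul, Nat.cast_add,
          Nat.cast_one]
        congr 2
        field_simp
  exact key l h hl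

lemma sd_mem (n k : ℕ) : k ≤ n + 1 → ∀ (l : List V) (D : ℝ) (C : Set V), 0 ≤ D → Convex ℝ C →
    l.length = k →
    (∀ v ∈ l, v ∈ C) → (∀ v ∈ l, ∀ u ∈ l, ‖v - u‖ ≤ D) →
    sd k (lst l) ∈ Sp (fun l' => l'.length = k ∧ (∀ v ∈ l', v ∈ C) ∧
      ∀ v ∈ l', ∀ u ∈ l', ‖v - u‖ ≤ (n / (n + 1) : ℝ) * D) := by
  induction k with
  | zero =>
    intro _ l D C hD hC hl h1 h2
    have : l = [] := List.length_eq_zero_iff.1 hl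
    subst this
    exact lst_mem (by simp)
  | succ k ih =>
    intro hk l D C hD hC hl h1 h2
    rw [sd_lst]
    have hne : l ≠ [] := by rintro rfl; simp at hl
    set B : Set V := {x | ‖x - bary l‖ ≤ (n / (n + 1) : ℝ) * D} with hB
    have hBc : Convex ℝ B := by
      have : B = Metric.closedBall (bary l) ((n / (n + 1) : ℝ) * D) := by
        ext x; simp [hB, dist_eq_norm]
      rw [this]; exact convex_closedBall _ _
    have hlB : ∀ v ∈ l, v ∈ B := by
      intro v hv
      refine (bary_dist l k hl D h2 v hv).trans ?_
      refine mul_le_mul_of_nonneg_right ?_ hD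
      rw [div_le_div_iff₀ (by positivity) (by positivity)]
      have : (k : ℝ) ≤ n := by exact_mod_cast (by omega : k ≤ n)
      nlinarith
    have h3 : sd k (bdL l) ∈ Sp (fun l' => l'.length = k ∧ (∀ v ∈ l', v ∈ C ∩ B) ∧
      ∀ v ∈ l', ∀ u ∈ l', ‖v - u‖ ≤ (n / (n + 1) : ℝ) * D) := by
      refine Sp_map (sd k) _ ?_ (bdL_mem l)
      rintro l' ⟨ha, hb⟩
      exact ih (by omega) l' D (C ∩ B) hD (hC.inter hBc) (by omega)
        (fun v hv => ⟨h1 v (hb v hv), hlB v (hb v hv)⟩)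
        (fun v hv u hu => h2 v (hb v hv) u (hb u hu))
    refine Sp_map (cone (bary l)) _ ?_ h3
    rintro l' ⟨ha, hb, hc⟩
    rw [cone_lst]
    refine lst_mem ⟨by simp [ha], ?_, ?_⟩
    · intro v hv
      rcases List.mem_cons.1 hv with rfl | hv
      · exact bary_mem l hne C hC h1
      · exact (hb v hv).1
    · intro v hv u hu
      rcases List.mem_cons.1 hv with rfl | hv <;> rcases List.mem_cons.1 hu with rfl | hu
      · simp; positivity
      · rw [norm_sub_rev]; exact (hb u hu).2
      · exact (hb v hv).2
      · exact hc v hv u hu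

/-- Admissible systems of chains of mesh `D`. -/
def Good {ι : Type*} (n : ℕ) (C : ι → Set V) (D : ℝ) (c : ℕ → Ch V) : Prop :=
  (∀ k ≤ n, c k ∈ Sp (fun l => l.length = k + 1 ∧ (∃ i, ∀ v ∈ l, v ∈ C i) ∧
      ∀ v ∈ l, ∀ u ∈ l, ‖v - u‖ ≤ D)) ∧
  ev (fun _ => 1) (c 0) = 1 ∧
  ∀ k < n, bd (c (k + 1)) = c k + ant (c k)

lemma Good.sub {ι : Type*} {n : ℕ} {C : ι → Set V} (hC : ∀ i, Convex ℝ (C i)) {D : ℝ}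
    (hD : 0 ≤ D) {c : ℕ → Ch V} (h : Good n C D c) :
    Good n C ((n / (n + 1) : ℝ) * D) (fun k => sd (k + 1) (c k)) := by
  obtain ⟨h1, h2, h3⟩ := h
  refine ⟨?_, ?_, ?_⟩
  · intro k hk
    refine Sp_map (sd (k + 1)) _ ?_ (h1 k hk)
    rintro l ⟨ha, ⟨i, hi⟩, hb⟩
    refine Sp_mono ?_ (sd_mem n (k + 1) (by omega) l D (C i) hD (hC i) ha hi hb)
    rintro l' ⟨p, q, r⟩
    exact ⟨p, ⟨i, q⟩, r⟩
  · refine Eq.trans ?_ h2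
    refine Sp_eq (ev (fun _ => 1) ∘ₗ sd (0 + 1)) (ev (fun _ => 1)) ?_ (h1 0 (by omega))
    rintro l ⟨ha, -⟩
    match l, ha with
    | [v], _ =>
      rw [LinearMap.comp_apply, sd_lst]
      simp [sd, bdL]
  · intro k hk
    have : bd (sd (k + 1 + 1) (c (k + 1))) = sd (k + 1) (bd (c (k + 1))) := by
      refine Sp_comm bd (sd (k + 1 + 1)) (sd (k + 1)) bd ?_ (h1 (k + 1) (by omega))
      rintro l ⟨ha, -⟩
      simp only [bd_lst]
      exact bd_sd_lst (k + 1) l ha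
    simp only
    rw [this, h3 k hk, map_add, sd_ant]

lemma Good.exists_small {ι : Type*} {n : ℕ} {C : ι → Set V} (hC : ∀ i, Convex ℝ (C i)) {D : ℝ}
    (hD : 0 ≤ D) {c : ℕ → Ch V} (h : Good n C D c) {δ : ℝ} (hδ : 0 < δ) :
    ∃ D' < δ, ∃ c', Good n C D' c' := by
  have hr : (n / (n + 1) : ℝ) < 1 := by rw [div_lt_one (by positivity)]; linarith
  have key : ∀ N : ℕ, ∃ c', Good n C ((n / (n + 1) : ℝ) ^ N * D) c' := by
    intro N
    induction N with
    | zero => exact ⟨c, by simpa using h⟩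
    | succ N ih =>
      obtain ⟨c', hc'⟩ := ih
      have := hc'.sub hC (by positivity)
      rw [← mul_assoc, ← pow_succ'] at this
      exact ⟨_, this⟩
  have ht : Filter.Tendsto (fun N : ℕ => (n / (n + 1) : ℝ) ^ N * D) Filter.atTop (nhds (0 * D)) :=
    (tendsto_pow_atTop_nhds_zero_of_lt_one (by positivity) hr).mul_const D
  rw [zero_mul] at ht
  obtain ⟨N, hN⟩ := (ht.eventually (gt_mem_nhds hδ)).exists
  exact ⟨_, hN, key N⟩

end sub

/-! ### The octahedral sphere -/

section oct

def ee (n k : ℕ) : Fin (n + 1) → ℝ := fun i => if i.1 = k then 1 else 0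

def oc (n : ℕ) : ℕ → Ch (Fin (n + 1) → ℝ)
  | 0 => lst [ee n 0]
  | k + 1 => cone (ee n (k + 1)) (oc n k + ant (oc n k))

def Cs (n : ℕ) (ε : {ε : ℕ → ℝ // ∀ i, ε i = 1 ∨ ε i = -1}) : Set (Fin (n + 1) → ℝ) :=
  {x | ‖x‖ ≤ 1 ∧ 1 ≤ ∑ i : Fin (n + 1), ε.1 i * x i}

lemma Cs_convex (n : ℕ) (ε) : Convex ℝ (Cs n ε) := by
  have h1 : Convex ℝ {x : Fin (n + 1) → ℝ | ‖x‖ ≤ 1} := by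
    have : {x : Fin (n + 1) → ℝ | ‖x‖ ≤ 1} = Metric.closedBall 0 1 := by ext; simp
    rw [this]; exact convex_closedBall _ _
  refine h1.inter (convex_halfSpace_ge (f := fun x : Fin (n + 1) → ℝ => ∑ i : Fin (n + 1), ε.1 i * x i) ?_ 1)
  constructor
  · intro x y; simp [mul_add, Finset.sum_add_distrib]
  · intro a x
    simp only [Pi.smul_apply, smul_eq_mul, Finset.mul_sum]
    exact Finset.sum_congr rfl (fun i _ => by ring)

lemma oc_bd (n k : ℕ) : bd (oc n (k + 1)) = oc n k + ant (oc n k) := by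
  have : bd (oc n k + ant (oc n k)) = 0 := by
    cases k with
    | zero => simp [oc, bdL, ch_add_self]
    | succ k =>
      have h := oc_bd n k
      rw [map_add, bd_ant, h, map_add, ant_ant, add_comm (ant _), ch_add_self]
  rw [oc, bd_cone, this, map_zero, add_zero]

lemma oc_mem (n k : ℕ) : oc n k ∈ Sp (fun l => l.length = k + 1 ∧
    ∃ ε : ℕ → ℝ, (∀ i, ε i = 1 ∨ ε i = -1) ∧ ∀ v ∈ l, ∃ i ≤ k, v = ε i • ee n i) := by
  induction k with
  | zero => exact lst_mem ⟨rfl, fun _ => 1, by simp, by simp⟩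
  | succ k ih =>
    have hant : ant (oc n k) ∈ Sp (fun l => l.length = k + 1 ∧
        ∃ ε : ℕ → ℝ, (∀ i, ε i = 1 ∨ ε i = -1) ∧ ∀ v ∈ l, ∃ i ≤ k, v = ε i • ee n i) := by
      refine Sp_map ant _ ?_ ih
      rintro l ⟨h1, ε, h2, h3⟩
      rw [ant_lst]
      refine lst_mem ⟨by simpa using h1, fun i => - ε i, fun i => ?_, ?_⟩
      · rcases h2 i with h | h <;> simp [h]
      · intro v hv
        obtain ⟨u, hu, rfl⟩ := List.mem_map.1 hv
        obtain ⟨i, hi, rfl⟩ := h3 u hu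
        exact ⟨i, hi, by simp⟩
    refine Sp_map (cone _) _ ?_ (add_mem ih hant)
    rintro l ⟨h1, ε, h2, h3⟩
    rw [cone_lst]
    refine lst_mem ⟨by simpa using h1, Function.update ε (k + 1) 1, fun i => ?_, ?_⟩
    · by_cases h : i = k + 1
      · subst h; simp
      · simpa [Function.update_of_ne h] using h2 i
    · intro v hv
      rcases List.mem_cons.1 hv with rfl | hv
      · exact ⟨k + 1, le_rfl, by simp⟩
      · obtain ⟨i, hi, rfl⟩ := h3 v hv
        exact ⟨i, by omega, by rw [Function.update_of_ne (by omega)]⟩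

lemma oc_good (n : ℕ) : Good n (Cs n) 2 (oc n) := by
  refine ⟨fun k hk => Sp_mono ?_ (oc_mem n k), by simp [oc], fun k _ => oc_bd n k⟩
  rintro l ⟨h1, ε, h2, h3⟩
  have h4 : ∀ v ∈ l, v ∈ Cs n ⟨ε, h2⟩ := by
    intro v hv
    obtain ⟨i, hi, rfl⟩ := h3 v hv
    have ha : |ε i| = 1 := by rcases h2 i with h | h <;> simp [h]
    have hb : ε i * ε i = 1 := by rcases h2 i with h | h <;> simp [h]
    constructor
    · rw [pi_norm_le_iff_of_nonneg zero_le_one]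
      intro j
      simp only [ee, Pi.smul_apply, smul_eq_mul, Real.norm_eq_abs, abs_mul, ha]
      split_ifs <;> simp
    · rw [Finset.sum_eq_single (⟨i, by omega⟩ : Fin (n + 1))]
      · simp [ee, hb]
      · intro j _ hj
        have : j.1 ≠ i := fun h => hj (Fin.ext h)
        simp [ee, this]
      · simp
  refine ⟨h1, ⟨⟨ε, h2⟩, h4⟩, ?_⟩
  intro v hv u hu
  have := (h4 v hv).1
  have := (h4 u hu).1
  have := norm_sub_le v u
  linarith

/-- Borsuk–Ulam. -/
theorem borsuk_ulam (n : ℕ) (g : (Fin (n + 1) → ℝ) → (Fin n → ℝ)) (hg : ContinuousOn g {0}ᶜ)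
    (hodd : ∀ x ≠ 0, g (-x) = - g x) : ∃ x ≠ 0, g x = 0 := by
  classical
  by_contra! hne
  set K : Set (Fin (n + 1) → ℝ) := {x | ‖x‖ ≤ 1 ∧ 1 ≤ ∑ i : Fin (n + 1), |x i|} with hK
  have hKc : IsCompact K := by
    have h1 : IsCompact (Metric.closedBall (0 : Fin (n + 1) → ℝ) 1) := isCompact_closedBall _ _
    refine h1.of_isClosed_subset ?_ ?_
    · exact (isClosed_le continuous_norm continuous_const).inter
        (isClosed_le continuous_const
          (continuous_finsetSum _ fun i _ => (continuous_apply i).abs))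
    · intro x hx; simpa using hx.1
  have hK0 : ∀ x ∈ K, x ≠ 0 := by
    rintro x ⟨-, hx⟩ rfl
    simp at hx
    linarith
  have hCK : ∀ ε, Cs n ε ⊆ K := by
    rintro ε x ⟨h1, h2⟩
    refine ⟨h1, h2.trans (Finset.sum_le_sum fun i _ => ?_)⟩
    refine (le_abs_self _).trans ?_
    rw [abs_mul]
    rcases ε.2 i with h | h <;> simp [h]
  have hgK : ContinuousOn g K := hg.mono (fun x hx => hK0 x hx)
  obtain ⟨m, hm, hmK⟩ : ∃ m > 0, ∀ x ∈ K, m ≤ ‖g x‖ := by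
    rcases K.eq_empty_or_nonempty with h | h
    · exact ⟨1, one_pos, by simp [h]⟩
    · obtain ⟨x, hx, hmin⟩ := hKc.exists_isMinOn h hgK.norm
      exact ⟨‖g x‖, norm_pos_iff.2 (hne x (hK0 x hx)), fun y hy => hmin hy⟩
  have huc := hKc.uniformContinuousOn_of_continuous hgK
  rw [Metric.uniformContinuousOn_iff] at huc
  obtain ⟨δ, hδ, huc⟩ := huc m hm
  obtain ⟨D, hD, c, hc1, hc2, hc3⟩ :=
    (oc_good n).exists_small (Cs_convex n) (by norm_num) hδ
  let τ : (Fin (n + 1) → ℝ) → ZMod 2 := fun x => if 0 < toLex x then 1 else 0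
  have hτ : ∀ x ≠ 0, τ x + τ (-x) = 1 := by
    intro x hx
    have hx' : toLex x ≠ 0 := hx
    have e : 0 < toLex (-x) ↔ toLex x < 0 := Left.neg_pos_iff (a := toLex x)
    rcases lt_or_gt_of_ne hx' with h | h
    · have h1 : τ x = 0 := if_neg (not_lt.2 h.le)
      have h2 : τ (-x) = 1 := if_pos (e.2 h)
      rw [h1, h2, zero_add]
    · have h1 : τ x = 1 := if_pos h
      have h2 : τ (-x) = 0 := if_neg (fun h' => not_lt.2 h.le (e.1 h'))
      rw [h1, h2, add_zero]
  let s : Fin n → (Fin (n + 1) → ℝ) → ZMod 2 := fun i x =>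
    if 0 < g x i then 1 else if g x i < 0 then 0 else τ x
  have hs : ∀ i, ∀ x ≠ 0, s i x + s i (-x) = 1 := by
    intro i x hx
    simp only [s, hodd x hx, Pi.neg_apply, Left.neg_pos_iff, Left.neg_neg_iff]
    rcases lt_trichotomy (g x i) 0 with h | h | h
    · simp [h, not_lt.2 h.le]
    · simp [h, hτ x hx]
    · simp [h, not_lt.2 h.le]
  have hW := W_chain c n (fun k hk => Sp_mono (by
      rintro l ⟨h1, ⟨ε, h2⟩, -⟩
      exact ⟨h1, fun v hv => hK0 v (hCK ε (h2 v hv))⟩) (hc1 k hk)) hc2 hc3 (List.ofFn s)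
    (by intro t ht; obtain ⟨i, rfl⟩ := List.mem_ofFn.1 ht; exact hs i) (by simp)
  have h0 : ev (Wc (List.ofFn s)) (c (List.ofFn s).length) = 0 := by
    refine Sp_eq (ev (Wc (List.ofFn s))) 0 ?_ (hc1 _ (by simp))
    rintro l ⟨h1, ⟨ε, h2⟩, h3⟩
    rw [ev_lst, LinearMap.zero_apply]
    refine W_zero _ l h1 ?_
    match l, h1 with
    | v :: l, h1 =>
      have hvK : v ∈ K := hCK ε (h2 v (by simp))
      obtain ⟨i, hi⟩ : ∃ i, m ≤ |g v i| := by
        by_contra! h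
        have := (pi_norm_lt_iff (x := g v) hm).2 (fun i => by simpa using h i)
        exact absurd (hmK v hvK) (not_le.2 this)
      refine ⟨s i, List.mem_ofFn.2 ⟨i, rfl⟩, ?_⟩
      have hconst : ∀ u ∈ v :: l, s i u = s i v := by
        intro u hu
        have huK : u ∈ K := hCK ε (h2 u hu)
        have hd := huc u huK v hvK (by
          rw [dist_eq_norm]; exact (h3 u hu v (by simp)).trans_lt hD)
        have hd2 := (dist_le_pi_dist (g u) (g v) i).trans_lt hd
        rw [Real.dist_eq, abs_lt] at hd2
        rcases le_abs.1 hi with h | h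
        · have p1 : 0 < g v i := by linarith
          have p2 : 0 < g u i := by linarith
          simp [s, p1, p2]
        · have p1 : g v i < 0 := by linarith
          have p2 : g u i < 0 := by linarith
          simp [s, p1, p2, not_lt.2 p1.le, not_lt.2 p2.le]
      intro a ha b hb
      rw [hconst a ha, hconst b hb]
  rw [h0] at hW
  exact absurd hW (by decide)

end oct

end

end GapBU

lemma gap_near {X : Type*} [NormedAddCommGroup X] [NormedSpace ℝ X]
    (M N : Submodule ℝ X) (hgap : subspaceGap M N < 1) (x : X) (hx : x ∈ M) (hx0 : x ≠ 0) :
    ∃ y ∈ N, ‖x - y‖ < ‖x‖ := by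
  have hn : 0 < ‖x‖ := norm_pos_iff.2 hx0
  have hbdd : BddAbove {d : ℝ | ∃ x ∈ M, ‖x‖ = 1 ∧ d = Metric.infDist x (N : Set X)} := by
    refine ⟨1, ?_⟩
    rintro d ⟨z, -, hz, rfl⟩
    refine (Metric.infDist_le_dist_of_mem (N.zero_mem)).trans ?_
    simp [hz]
  have h1 : Metric.infDist (‖x‖⁻¹ • x) (N : Set X) < 1 :=
    (le_csSup hbdd ⟨‖x‖⁻¹ • x, M.smul_mem _ hx, by
      rw [norm_smul, norm_inv, norm_norm, inv_mul_cancel₀ hn.ne'], rfl⟩).trans_lt hgap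
  obtain ⟨y, hy, hd⟩ := (Metric.infDist_lt_iff ⟨0, N.zero_mem⟩).1 h1
  refine ⟨‖x‖ • y, N.smul_mem _ hy, ?_⟩
  have : x - ‖x‖ • y = ‖x‖ • (‖x‖⁻¹ • x - y) := by
    rw [smul_sub, smul_inv_smul₀ hn.ne']
  rw [this, norm_smul, norm_norm, ← dist_eq_norm]
  nlinarith

/-- The small gap theorem of Gohberg–Krein: if `δ(M, N) < 1` and `M` is
finite-dimensional then `dim M ≤ dim N`. -/
theorem stmt6 {X : Type*} [NormedAddCommGroup X] [NormedSpace ℝ X] [CompleteSpace X]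
    (M N : Submodule ℝ X) (hgap : subspaceGap M N < 1) (hM : FiniteDimensional ℝ M) :
    Module.rank ℝ M ≤ Module.rank ℝ N := by
  by_contra! hlt
  have hN : FiniteDimensional ℝ N := by
    rw [FiniteDimensional, ← Module.rank_lt_aleph0_iff]
    exact hlt.trans (Module.rank_lt_aleph0 ℝ M)
  have hfr : Module.finrank ℝ N < Module.finrank ℝ M := by
    rw [← Module.finrank_eq_rank, ← Module.finrank_eq_rank] at hlt
    exact_mod_cast hlt
  obtain ⟨n, hn⟩ : ∃ n, Module.finrank ℝ M = n + 1 := ⟨Module.finrank ℝ M - 1, by omega⟩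
  let L : (Fin (n + 1) → ℝ) ≃L[ℝ] M := ContinuousLinearEquiv.ofFinrankEq (by simp [hn])
  obtain ⟨φ, hφ⟩ : ∃ φ : N →ₗ[ℝ] (Fin n → ℝ), Function.Injective φ := by
    have hle : Module.finrank ℝ N ≤ n := by omega
    exact finrank_le_iff_exists_linearMap.1 (by simpa using hle)
  have hφc : Continuous φ := φ.continuous_of_finiteDimensional
  let Y := {x : Fin (n + 1) → ℝ // x ≠ 0}
  let t : Y → Set N := fun x => {y | ‖(L x.1 : X) - y‖ < ‖(L x.1 : X)‖}
  have hL0 : ∀ x : Y, (L x.1 : X) ≠ 0 := by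
    intro x h
    have : L x.1 = 0 := by exact_mod_cast h
    exact x.2 (by simpa using this)
  have hLc : Continuous fun x : Y => (L x.1 : X) :=
    continuous_subtype_val.comp (L.continuous.comp continuous_subtype_val)
  have ht : ∀ x, Convex ℝ (t x) := by
    intro x
    have : t x = N.subtype ⁻¹' (Metric.ball (L x.1 : X) ‖(L x.1 : X)‖) := by
      ext y; simp [t, dist_eq_norm, norm_sub_rev]
    rw [this]
    exact (convex_ball _ _).linear_preimage _
  obtain ⟨f, hf⟩ := exists_continuous_forall_mem_convex_of_local_const ht (by
    intro x
    obtain ⟨y, hy, hd⟩ := gap_near M N hgap (L x.1 : X) (L x.1).2 (hL0 x)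
    refine ⟨⟨y, hy⟩, ?_⟩
    exact (hLc.sub continuous_const).norm.continuousAt.eventually_lt hLc.norm.continuousAt hd)
  let ng : Y → Y := fun x => ⟨-x.1, neg_ne_zero.2 x.2⟩
  have hng : Continuous ng := by
    apply Continuous.subtype_mk
    exact continuous_subtype_val.neg
  let h : Y → N := fun x => f x - f (ng x)
  have hh : Continuous h := f.continuous.sub (f.continuous.comp hng)
  have hh0 : ∀ x, h x ≠ 0 := by
    intro x h0
    have h1 : ‖(L x.1 : X) - f x‖ < ‖(L x.1 : X)‖ := hf x
    have h2 : ‖(L (-x.1) : X) - f (ng x)‖ < ‖(L (-x.1) : X)‖ := hf (ng x)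
    have h3 : f (ng x) = f x := (sub_eq_zero.1 h0).symm
    rw [h3, map_neg] at h2
    simp only [Submodule.coe_neg, norm_neg] at h2
    have h4 := norm_sub_le ((L x.1 : X) - f x) (-(L x.1 : X) - f x)
    have h5 : ((L x.1 : X) - f x) - (-(L x.1 : X) - f x) = (2 : ℝ) • (L x.1 : X) := by
      rw [two_smul]; abel
    rw [h5, norm_smul] at h4
    norm_num at h4
    linarith
  classical
  obtain ⟨x, hx, hgx⟩ := GapBU.borsuk_ulam n
    (fun x => if hx : x ≠ 0 then φ (h ⟨x, hx⟩) else 0) (by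
      rw [continuousOn_iff_continuous_domRestrict]
      have : Continuous fun x : Y => φ (h x) := hφc.comp hh
      refine this.congr fun x => ?_
      have hx : x.1 ≠ 0 := x.2
      change _ = (if hx : x.1 ≠ 0 then φ (h ⟨x.1, hx⟩) else 0)
      rw [dif_pos hx]) (by
      intro x hx
      have hx' : -x ≠ 0 := neg_ne_zero.2 hx
      rw [dif_pos hx, dif_pos hx', ← map_neg]
      congr 1
      have : ng (ng ⟨x, hx⟩) = ⟨x, hx⟩ := Subtype.ext (neg_neg x)
      change h (ng ⟨x, hx⟩) = _
      simp only [h, this, neg_sub])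
  rw [dif_pos hx] at hgx
  exact hh0 _ (hφ (by rw [hgx, map_zero]))
end

section
/- Let M, N be closed subspaces of a Banach space X with M ∩ N = {0} and M + N not closed. Then for every ε > 0 there exist infinite-dimensional closed subspaces H ⊆ M and G ⊆ N with max(δ(H,G), δ(G,H)) < ε such that for every infinite-dimensional closed subspace K ⊆ H there exists an infinite-dimensional closed subspace L ⊆ G with K + L not closed and max(δ(K,L), δ(L,K)) < ε. -/
lemma aux_closed_sup {X : Type*} [NormedAddCommGroup X] [NormedSpace ℝ X] [CompleteSpace X]
    (M N : Submodule ℝ X) (hM : IsClosed (M : Set X)) (hN : IsClosed (N : Set X))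
    (η : ℝ) (hη : 0 < η) (h : ∀ x ∈ M, ∀ y ∈ N, η * ‖x‖ ≤ ‖x - y‖) :
    IsClosed ((M ⊔ N : Submodule ℝ X) : Set X) := by
  have : CompleteSpace M := hM.completeSpace_coe
  have : CompleteSpace N := hN.completeSpace_coe
  let f : (M × N) →L[ℝ] X := (M.subtypeL.comp (ContinuousLinearMap.fst ℝ M N)) -
    (N.subtypeL.comp (ContinuousLinearMap.snd ℝ M N))
  have hf : ∀ p : M × N, f p = (p.1 : X) - p.2 := fun p => rfl
  have hanti : AntilipschitzWith (Real.toNNReal (1 + 1 / η)) f := by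
    refine ContinuousLinearMap.antilipschitz_of_bound f fun p => ?_
    rw [Real.coe_toNNReal _ (by positivity), hf]
    have h1 := h p.1 p.1.2 p.2 p.2.2
    have h2 : ‖(p.1 : X)‖ ≤ 1 / η * ‖(p.1 : X) - p.2‖ := by
      rw [div_mul_eq_mul_div, le_div_iff₀ hη]; linarith
    have h3 : ‖(p.2 : X)‖ ≤ ‖(p.1 : X)‖ + ‖(p.1 : X) - p.2‖ := by
      have := norm_sub_le (p.1 : X) ((p.1 : X) - p.2)
      simpa using this
    have h4 := norm_nonneg ((p.1 : X) - p.2)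
    rw [Prod.norm_def]
    refine max_le ?_ ?_
    · rw [Submodule.coe_norm]; nlinarith
    · rw [Submodule.coe_norm]; nlinarith
  have hc := hanti.isClosed_range f.uniformContinuous
  have : ((M ⊔ N : Submodule ℝ X) : Set X) = Set.range f := by
    ext z
    simp only [SetLike.mem_coe, Submodule.mem_sup, Set.mem_range]
    constructor
    · rintro ⟨x, hx, y, hy, rfl⟩
      exact ⟨(⟨x, hx⟩, ⟨-y, N.neg_mem hy⟩), by rw [hf]; simp⟩
    · rintro ⟨p, rfl⟩
      exact ⟨p.1, p.1.2, -p.2, N.neg_mem p.2.2, by rw [hf]; abel⟩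
  rw [this]; exact hc

lemma aux_bound {X : Type*} [NormedAddCommGroup X] [NormedSpace ℝ X] [CompleteSpace X]
    (M N : Submodule ℝ X) (hM : IsClosed (M : Set X)) (hN : IsClosed (N : Set X))
    (hMN : M ⊓ N = ⊥) (hc : IsClosed ((M ⊔ N : Submodule ℝ X) : Set X)) :
    ∃ c > (0 : ℝ), ∀ x ∈ M, ∀ y ∈ N, c * ‖x‖ ≤ ‖x - y‖ := by
  have : CompleteSpace M := hM.completeSpace_coe
  have : CompleteSpace N := hN.completeSpace_coe
  let f : (M × N) →L[ℝ] X := (M.subtypeL.comp (ContinuousLinearMap.fst ℝ M N)) -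
    (N.subtypeL.comp (ContinuousLinearMap.snd ℝ M N))
  have hf : ∀ p : M × N, f p = (p.1 : X) - p.2 := fun p => rfl
  have : ((M ⊔ N : Submodule ℝ X) : Set X) = Set.range f := by
    ext z
    simp only [SetLike.mem_coe, Submodule.mem_sup, Set.mem_range]
    constructor
    · rintro ⟨x, hx, y, hy, rfl⟩
      exact ⟨(⟨x, hx⟩, ⟨-y, N.neg_mem hy⟩), by rw [hf]; simp⟩
    · rintro ⟨p, rfl⟩
      exact ⟨p.1, p.1.2, -p.2, N.neg_mem p.2.2, by rw [hf]; abel⟩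
  rw [this] at hc
  have hinj : Function.Injective f := by
    rw [injective_iff_map_eq_zero]
    intro p hp
    rw [hf, sub_eq_zero] at hp
    have h0 : (p.1 : X) ∈ M ⊓ N := ⟨p.1.2, hp ▸ p.2.2⟩
    rw [hMN, Submodule.mem_bot] at h0
    have h1 : (p.2 : X) = 0 := hp ▸ h0
    exact Prod.ext (Subtype.ext h0) (Subtype.ext h1)
  obtain ⟨K, hK⟩ := f.antilipschitz_of_injective_of_isClosed_range hinj hc
  have hb : ∀ p : M × N, ‖p‖ ≤ K * ‖f p‖ := fun p => by
    simpa using hK.le_mul_dist p 0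
  refine ⟨1 / ((K : ℝ) + 1), by positivity, fun x hx y hy => ?_⟩
  have h1 := hb (⟨x, hx⟩, ⟨y, hy⟩)
  rw [hf, Prod.norm_def] at h1
  have h2 : ‖x‖ ≤ K * ‖x - y‖ := (le_max_left _ _).trans h1
  rw [div_mul_eq_mul_div, div_le_iff₀ (by positivity)]
  have := norm_nonneg (x - y)
  nlinarith

lemma aux_step {X : Type*} [NormedAddCommGroup X] [NormedSpace ℝ X] [CompleteSpace X]
    (M N : Submodule ℝ X) (hM : IsClosed (M : Set X)) (hN : IsClosed (N : Set X))
    (hsum : ¬IsClosed ((M ⊔ N : Submodule ℝ X) : Set X))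
    {V : Type*} [NormedAddCommGroup V] [NormedSpace ℝ V] [FiniteDimensional ℝ V]
    (A : X →L[ℝ] V) (η : ℝ) (hη : 0 < η) :
    ∃ x ∈ M, ∃ y ∈ N, A x = 0 ∧ ‖x‖ = 1 ∧ ‖x - y‖ < η := by
  by_contra! hcon
  apply hsum
  let M' : Submodule ℝ X := M ⊓ LinearMap.ker (A : X →ₗ[ℝ] V)
  have hM' : IsClosed (M' : Set X) := hM.inter A.isClosed_ker
  have h1 : IsClosed ((M' ⊔ N : Submodule ℝ X) : Set X) := by
    refine aux_closed_sup M' N hM' hN η hη fun x hx y hy => ?_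
    by_cases hx0 : x = 0
    · simp [hx0]
    have hpos : 0 < ‖x‖ := norm_pos_iff.2 hx0
    have hA : A x = 0 := hx.2
    have := hcon (‖x‖⁻¹ • x) (M.smul_mem _ hx.1) (‖x‖⁻¹ • y) (N.smul_mem _ hy) (by simp [hA])
      (by rw [norm_smul, norm_inv, norm_norm, inv_mul_cancel₀ hpos.ne'])
    rw [← smul_sub, norm_smul, norm_inv, norm_norm, inv_mul_eq_div, le_div_iff₀ hpos] at this
    exact this
  let g : M →ₗ[ℝ] V := (A : X →ₗ[ℝ] V) ∘ₗ M.subtype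
  obtain ⟨E, hE⟩ := Submodule.exists_isCompl (LinearMap.ker g)
  have : FiniteDimensional ℝ E := by
    refine FiniteDimensional.of_injective (g ∘ₗ E.subtype) ?_
    rw [injective_iff_map_eq_zero]
    intro e he
    have : (e : M) ∈ LinearMap.ker g ⊓ E := ⟨he, e.2⟩
    rw [hE.inf_eq_bot, Submodule.mem_bot] at this
    exact Subtype.ext this
  have h2 := Submodule.isClosed_sup_finiteDimensional (M' ⊔ N) (E.map M.subtype) h1
  have h3 : M' ⊔ N ⊔ E.map M.subtype = M ⊔ N := by
    apply le_antisymm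
    · refine sup_le (sup_le_sup_right inf_le_left _) (le_sup_of_le_left ?_)
      exact Submodule.map_subtype_le M E
    · refine sup_le ?_ (le_sup_of_le_left le_sup_right)
      intro x hx
      have : (⟨x, hx⟩ : M) ∈ LinearMap.ker g ⊔ E := by rw [hE.sup_eq_top]; trivial
      obtain ⟨a, ha, b, hb, hab⟩ := Submodule.mem_sup.1 this
      have hx' : x = (a : X) + b := by
        have := congrArg Subtype.val hab
        exact this.symm
      rw [hx']
      refine Submodule.add_mem_sup (Submodule.mem_sup_left ⟨a.2, ha⟩) ⟨b, hb, rfl⟩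
  rw [← h3]; exact h2

lemma aux_seq {X : Type*} [NormedAddCommGroup X] [NormedSpace ℝ X] [CompleteSpace X]
    (M N : Submodule ℝ X) (hM : IsClosed (M : Set X)) (hN : IsClosed (N : Set X))
    (hsum : ¬IsClosed ((M ⊔ N : Submodule ℝ X) : Set X)) (η : ℝ) (hη : 0 < η) :
    ∃ (x y : ℕ → X) (f : ℕ → X →L[ℝ] ℝ), (∀ n, x n ∈ M) ∧ (∀ n, y n ∈ N) ∧
      (∀ n, f n (x n) = 1) ∧ (∀ m n, m ≠ n → f m (x n) = 0) ∧
      ∀ n, ‖f n‖ * ‖x n - y n‖ ≤ η * (1 / 2) ^ n := by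
  classical
  obtain ⟨u, hu, hr⟩ := exists_seq_of_forall_finset_exists
    (α := X × X × (X →L[ℝ] ℝ) × ℕ)
    (fun a => a.1 ∈ M ∧ a.2.1 ∈ N ∧ a.2.2.1 a.1 = 1 ∧
      ‖a.2.2.1‖ * ‖a.1 - a.2.1‖ ≤ η * (1 / 2) ^ a.2.2.2)
    (fun a b => a.2.2.1 b.1 = 0 ∧ b.2.2.1 a.1 = 0 ∧ a.2.2.2 < b.2.2.2) (by
      intro s hs
      let F : Submodule ℝ X := Submodule.span ℝ ((s.image fun a => a.1 : Finset X) : Set X)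
      have : FiniteDimensional ℝ F := FiniteDimensional.span_finset ℝ _
      obtain ⟨P, hP⟩ := Submodule.ClosedComplemented.of_finiteDimensional (𝕜 := ℝ) F
      let Q : X →L[ℝ] X := ContinuousLinearMap.id ℝ X - F.subtypeL.comp P
      let i : ℕ := s.sup (fun a => a.2.2.2) + 1
      let A : X →L[ℝ] (F × (s → ℝ)) := P.prod (ContinuousLinearMap.pi fun a => a.1.2.2.1)
      obtain ⟨x, hx, y, hy, hA, hn, hxy⟩ := aux_step M N hM hN hsum A
        (η * (1 / 2) ^ i / (‖Q‖ + 1)) (by positivity)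
      obtain ⟨g, hg1, hg2⟩ := exists_dual_vector'' ℝ x
      have hPx : P x = 0 := congrArg Prod.fst hA
      have hfx : ∀ a ∈ s, a.2.2.1 x = 0 := fun a ha =>
        congrFun (congrArg Prod.snd hA) ⟨a, ha⟩
      refine ⟨(x, y, g.comp Q, i), ⟨hx, hy, ?_, ?_⟩, fun a ha => ⟨hfx a ha, ?_, ?_⟩⟩
      · simp [Q, hPx, hg2, hn]
      · have h1 : ‖g.comp Q‖ ≤ ‖Q‖ + 1 := by
          refine (g.opNorm_comp_le Q).trans ?_
          have := norm_nonneg Q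
          nlinarith
        rw [lt_div_iff₀ (by positivity)] at hxy
        have h2 := norm_nonneg (x - y)
        change ‖g.comp Q‖ * ‖x - y‖ ≤ η * (1 / 2) ^ i
        nlinarith
      · have haF : a.1 ∈ F := Submodule.subset_span (by
          simp only [Finset.coe_image]; exact ⟨a, ha, rfl⟩)
        have h1 := hP ⟨a.1, haF⟩
        change P a.1 = _ at h1
        simp [Q, h1]
      · exact Nat.lt_succ_of_le (Finset.le_sup (f := fun a : X × X × (X →L[ℝ] ℝ) × ℕ => a.2.2.2) ha))
  refine ⟨fun n => (u n).1, fun n => (u n).2.1, fun n => (u n).2.2.1, fun n => (hu n).1,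
    fun n => (hu n).2.1, fun n => (hu n).2.2.1, ?_, fun n => (hu n).2.2.2.trans ?_⟩
  · intro m n hmn
    rcases lt_or_gt_of_ne hmn with h | h
    · exact (hr m n h).1
    · exact (hr n m h).2.1
  · have hmono : StrictMono fun n => (u n).2.2.2 := fun m n h => (hr m n h).2.2
    have : n ≤ (u n).2.2.2 := hmono.id_le n
    exact mul_le_mul_of_nonneg_left
      (pow_le_pow_of_le_one (by norm_num) (by norm_num) this) hη.le

lemma aux_gap_le {X : Type*} [NormedAddCommGroup X] [NormedSpace ℝ X]
    (M P : Submodule ℝ X) (b : ℝ) (hb : 0 ≤ b)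
    (h : ∀ x ∈ M, ‖x‖ = 1 → ∃ y ∈ P, ‖x - y‖ ≤ b) : subspaceGap M P ≤ b := by
  refine Real.sSup_le ?_ hb
  rintro d ⟨x, hx, hn, rfl⟩
  obtain ⟨y, hy, hxy⟩ := h x hx hn
  exact (Metric.infDist_le_dist_of_mem (s := (P : Set X)) hy).trans (by rwa [dist_eq_norm])

/-- Having a not closed sum is an inherent property: if `M ∩ N = {0}` and `M + N` is not
closed, then for every `ε > 0` there are infinite-dimensional closed subspaces `H ⊆ M`,
`G ⊆ N` with small mutual gaps such that every infinite-dimensional closed `K ⊆ H` admits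
an infinite-dimensional closed `L ⊆ G` with `K + L` not closed and small mutual gaps. -/
theorem stmt8 {X : Type*} [NormedAddCommGroup X] [NormedSpace ℝ X] [CompleteSpace X]
    (M N : Submodule ℝ X) (hM : IsClosed (M : Set X)) (hN : IsClosed (N : Set X))
    (hMN : M ⊓ N = ⊥) (hsum : ¬IsClosed ((M ⊔ N : Submodule ℝ X) : Set X)) :
    ∀ ε > (0 : ℝ), ∃ H G : Submodule ℝ X, H ≤ M ∧ G ≤ N ∧
      IsClosed (H : Set X) ∧ IsClosed (G : Set X) ∧
      ¬FiniteDimensional ℝ H ∧ ¬FiniteDimensional ℝ G ∧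
      max (subspaceGap H G) (subspaceGap G H) < ε ∧
      ∀ K : Submodule ℝ X, K ≤ H → IsClosed (K : Set X) → ¬FiniteDimensional ℝ K →
        ∃ L : Submodule ℝ X, L ≤ G ∧ IsClosed (L : Set X) ∧ ¬FiniteDimensional ℝ L ∧
          ¬IsClosed ((K ⊔ L : Submodule ℝ X) : Set X) ∧
          max (subspaceGap K L) (subspaceGap L K) < ε := by
  intro ε hε
  let η : ℝ := min (ε / 8) (1 / 4)
  have hη : 0 < η := by positivity
  have hη1 : η ≤ ε / 8 := min_le_left _ _
  have hη2 : η ≤ 1 / 4 := min_le_right _ _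
  obtain ⟨x, y, f, hx, hy, hf1, hf0, hfn⟩ := aux_seq M N hM hN hsum η hη
  let t : ℕ → X →L[ℝ] X := fun n => (f n).smulRight (x n - y n)
  have htn : ∀ n, ‖t n‖ ≤ η * (1 / 2) ^ n := fun n => by
    simpa [t, ContinuousLinearMap.norm_smulRight_apply] using hfn n
  have hgeo : HasSum (fun n : ℕ => η * (1 / 2 : ℝ) ^ n) (η * 2) :=
    hasSum_geometric_two.mul_left η
  have hts : Summable t := Summable.of_norm_bounded hgeo.summable htn
  let T : X →L[ℝ] X := ∑' n, t n
  have hTn : ‖T‖ ≤ η * 2 := tsum_of_norm_bounded hgeo htn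
  have hT : HasSum t T := hts.hasSum
  have hTx : ∀ n, T (x n) = x n - y n := by
    intro n
    have h1 : HasSum (fun k => t k (x n)) (T (x n)) :=
      hT.mapL (ContinuousLinearMap.apply ℝ X (x n))
    have h2 : HasSum (fun k => t k (x n)) (t n (x n)) := by
      refine hasSum_single n fun k hk => ?_
      simp [t, hf0 k n hk]
    rw [h1.unique h2]
    simp [t, hf1]
  have hTle : ∀ k, ‖T k‖ ≤ η * 2 * ‖k‖ := fun k => T.le_of_opNorm_le hTn k
  let S : X →L[ℝ] X := ContinuousLinearMap.id ℝ X - T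
  have hS : ∀ k, S k = k - T k := fun k => rfl
  have hSlow : ∀ k, ‖k‖ ≤ 2 * ‖S k‖ := fun k => by
    have h1 := hTle k
    have h2 : ‖k‖ ≤ ‖S k‖ + ‖T k‖ := by
      have := norm_add_le (S k) (T k)
      rwa [hS, sub_add_cancel] at this
    have := norm_nonneg k
    nlinarith
  have hSanti : AntilipschitzWith 2 S :=
    ContinuousLinearMap.antilipschitz_of_bound S fun k => by simpa using hSlow k
  let Lm : Submodule ℝ X → Submodule ℝ X := fun K => K.map (S : X →ₗ[ℝ] X)
  have hLclosed : ∀ K : Submodule ℝ X, IsClosed (K : Set X) → IsClosed (Lm K : Set X) := by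
    intro K hK
    have := (hSanti.isClosedEmbedding S.uniformContinuous).isClosedMap _ hK
    simpa [Lm] using this
  have hLinf : ∀ K : Submodule ℝ X, ¬FiniteDimensional ℝ K → ¬FiniteDimensional ℝ (Lm K) := by
    intro K hK hL
    apply hK
    exact Module.Finite.equiv
      (Submodule.equivMapOfInjective (S : X →ₗ[ℝ] X) hSanti.injective K).symm
  have hgap : ∀ K : Submodule ℝ X, max (subspaceGap K (Lm K)) (subspaceGap (Lm K) K) < ε := by
    intro K
    refine lt_of_le_of_lt (b := η * 4) (max_le ?_ ?_) (by linarith)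
    · refine aux_gap_le _ _ _ (by positivity) fun k hk hn => ⟨S k, ⟨k, hk, rfl⟩, ?_⟩
      have := hTle k
      rw [hS, sub_sub_cancel]
      rw [hn] at this
      linarith
    · refine aux_gap_le _ _ _ (by positivity) ?_
      rintro _ ⟨k, hk, rfl⟩ hn
      refine ⟨k, hk, ?_⟩
      change ‖S k‖ = 1 at hn
      change ‖S k - k‖ ≤ _
      have h1 := hTle k
      have h2 := hSlow k
      rw [hn] at h2
      rw [hS, sub_sub_cancel_left, norm_neg]
      nlinarith
  let H : Submodule ℝ X := (Submodule.span ℝ (Set.range x)).topologicalClosure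
  have hHM : H ≤ M := Submodule.topologicalClosure_minimal _
    (Submodule.span_le.2 (by rintro _ ⟨n, rfl⟩; exact hx n)) hM
  have hHN : H ≤ N.comap (S : X →ₗ[ℝ] X) := by
    refine Submodule.topologicalClosure_minimal _ (Submodule.span_le.2 ?_) ?_
    · rintro _ ⟨n, rfl⟩
      change S (x n) ∈ N
      rw [hS, hTx, sub_sub_cancel]
      exact hy n
    · exact hN.preimage S.continuous
  have hHc : IsClosed (H : Set X) := Submodule.isClosed_topologicalClosure _
  have hHinf : ¬FiniteDimensional ℝ H := by
    intro hfd
    have hxH : ∀ n, x n ∈ H := fun n =>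
      Submodule.le_topologicalClosure _ (Submodule.subset_span ⟨n, rfl⟩)
    have hli : LinearIndependent ℝ (fun n => (⟨x n, hxH n⟩ : H)) := by
      apply LinearIndependent.of_comp H.subtype
      rw [linearIndependent_iff']
      intro s g hg i hi
      have := congrArg (f i) hg
      rw [map_sum, map_zero, Finset.sum_eq_single i] at this
      · simpa [hf1] using this
      · intro j _ hj
        simp [hf0 i j hj.symm]
      · exact fun h => absurd hi h
    have := hli.finite
    exact not_finite ℕ
  refine ⟨H, Lm H, hHM, Submodule.map_le_iff_le_comap.2 hHN, hHc, hLclosed _ hHc, hHinf,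
    hLinf _ hHinf, hgap H, ?_⟩
  intro K hKH hKc hKinf
  refine ⟨Lm K, Submodule.map_mono hKH, hLclosed _ hKc, hLinf _ hKinf, ?_, hgap K⟩
  intro hcl
  have hKL : K ⊓ Lm K = ⊥ := by
    rw [eq_bot_iff, ← hMN]
    exact inf_le_inf (hKH.trans hHM)
      ((Submodule.map_mono hKH).trans (Submodule.map_le_iff_le_comap.2 hHN))
  obtain ⟨c, hc, hcb⟩ := aux_bound K (Lm K) hKc (hLclosed _ hKc) hKL hcl
  have htend := hT.tendsto_sum_nat
  obtain ⟨n, hn⟩ := ((Metric.tendsto_nhds.1 htend) c hc).exists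
  let g : K →ₗ[ℝ] (Fin n → ℝ) := LinearMap.pi fun i => (f i : X →ₗ[ℝ] ℝ) ∘ₗ K.subtype
  have hg : ¬Function.Injective g := fun h => hKinf (FiniteDimensional.of_injective g h)
  rw [injective_iff_map_eq_zero] at hg
  push Not at hg
  obtain ⟨k, hk, hk0⟩ := hg
  have hkf : ∀ i < n, f i (k : X) = 0 := fun i hi => congrFun hk ⟨i, hi⟩
  have h1 := hcb k k.2 (S k) ⟨k, k.2, rfl⟩
  rw [hS, sub_sub_cancel] at h1
  have h2 : (T - ∑ i ∈ Finset.range n, t i) (k : X) = T k := by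
    have : ∑ i ∈ Finset.range n, t i (k : X) = 0 := Finset.sum_eq_zero fun i hi => by
      simp [t, hkf i (Finset.mem_range.1 hi)]
    simp [ContinuousLinearMap.sum_apply, this]
  have h3 := (T - ∑ i ∈ Finset.range n, t i).le_opNorm (k : X)
  rw [h2] at h3
  rw [dist_comm, dist_eq_norm] at hn
  have hkpos : 0 < ‖(k : X)‖ := norm_pos_iff.2 fun h => hk0 (Subtype.ext h)
  nlinarith
end

section
/- Let X, Y be Banach spaces and A : X → Y a finitely strictly singular bounded operator. Then the finitely strictly singular uniform λ-adjustment of A with the zero operator equals 0: FSSλ[A, 0] = 0. Concretely: for every η > 0 and every sequence of finite-dimensional subspaces K_n of the graph G_A with dim K_n → ∞, there exist a subsequence and subspaces L_n ⊆ K_n with dim L_n → ∞ such that every unit vector (x, Ax) ∈ L_n satisfies ‖Ax‖ ≤ η. -/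
/-- The set of `λ ≥ 0` such that `(M_n)` is lower uniformly `λ`-adjusted with `(P_n)`
along the infinite index set `N'`. -/
def lowerAdjSet {X : Type*} [NormedAddCommGroup X] [NormedSpace ℝ X]
    (N' : Set ℕ) (M P : ℕ → Submodule ℝ X) : Set ℝ :=
  {lam : ℝ | 0 ≤ lam ∧
    ∀ η > (0 : ℝ), ∀ N'' ⊆ N', N''.Infinite →
      ∀ x : ℕ → X, (∀ n ∈ N'', x n ∈ M n ∧ ‖x n‖ = 1) →
        ∃ N''' ⊆ N'', N'''.Infinite ∧
          ∃ y : ℕ → X, (∀ n ∈ N''', y n ∈ P n) ∧ ∃ z : X,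
            Filter.limsup (fun n => ‖x n - y n - z‖)
              (Filter.atTop ⊓ Filter.principal N''') ≤ lam + η}

/-- The lower uniform `λ`-adjustment `λ_{N'}[M_n, P_n]`. -/
noncomputable def lambdaAdj {X : Type*} [NormedAddCommGroup X] [NormedSpace ℝ X]
    (N' : Set ℕ) (M P : ℕ → Submodule ℝ X) : ℝ :=
  sInf (lowerAdjSet N' M P)

open Filter Module

/-- The finitely strictly singular uniform λ-adjustment `FSSλ_{N'}[M_n, P_n]`. -/
noncomputable def fssLambdaAdj {X : Type*} [NormedAddCommGroup X] [NormedSpace ℝ X]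
    (N' : Set ℕ) (M P : ℕ → Submodule ℝ X) : ℝ :=
  sInf {lam : ℝ | 0 ≤ lam ∧
    ∀ N'' ⊆ N', N''.Infinite → ∀ K : ℕ → Submodule ℝ X,
      (∀ n ∈ N'', K n ≤ M n ∧ FiniteDimensional ℝ (K n)) →
      Tendsto (fun n => finrank ℝ (K n)) (atTop ⊓ 𝓟 N'') atTop →
      ∃ N''' ⊆ N'', N'''.Infinite ∧ ∃ L : ℕ → Submodule ℝ X,
        (∀ n ∈ N''', L n ≤ K n) ∧
        Tendsto (fun n => finrank ℝ (L n)) (atTop ⊓ 𝓟 N''') atTop ∧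
        lambdaAdj N''' L P ≤ lam}

theorem fss_finrank_map {V W : Type*} [AddCommGroup V] [Module ℝ V] [AddCommGroup W] [Module ℝ W]
    (f : V →ₗ[ℝ] W) (hf : Function.Injective f) (p : Submodule ℝ V) :
    finrank ℝ (p.map f) = finrank ℝ p :=
  (Submodule.equivMapOfInjective f hf p).finrank_eq.symm

theorem fss_core {X Y : Type*} [NormedAddCommGroup X] [NormedSpace ℝ X]
    [NormedAddCommGroup Y] [NormedSpace ℝ Y] (A : X →L[ℝ] Y)
    (hfss : ∀ ε > (0 : ℝ), ∃ n : ℕ, ∀ Z : Submodule ℝ X,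
      (n : Cardinal) ≤ Module.rank ℝ Z → ∃ z ∈ Z, z ≠ 0 ∧ ‖A z‖ < ε * ‖z‖) (k : ℕ) :
    ∀ ε > (0 : ℝ), ∃ N : ℕ, ∀ Z : Submodule ℝ X, FiniteDimensional ℝ Z → N ≤ finrank ℝ Z →
      ∃ W ≤ Z, k ≤ finrank ℝ W ∧ ∀ w ∈ W, ‖A w‖ ≤ ε * ‖w‖ := by
  induction k with
  | zero =>
    intro ε hε
    refine ⟨0, fun Z _ _ => ⟨⊥, bot_le, Nat.zero_le _, ?_⟩⟩
    intro w hw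
    rw [Submodule.mem_bot] at hw
    simp [hw]
  | succ k ih =>
    intro ε hε
    obtain ⟨n, hn⟩ := hfss (ε / 3) (by positivity)
    obtain ⟨N, hN⟩ := ih (ε / 3) (by positivity)
    refine ⟨max n (N + 1), fun Z hZ hd => ?_⟩
    obtain ⟨z, hzZ, hz0, hz⟩ := hn Z (by
      rw [← finrank_eq_rank]
      exact_mod_cast (le_max_left _ _).trans hd)
    obtain ⟨f, hf1, hfz⟩ := exists_dual_vector ℝ z (norm_ne_zero_iff.mpr hz0)
    have hfz' : f z = ‖z‖ := by simpa using hfz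
    have hzpos : 0 < ‖z‖ := norm_pos_iff.mpr hz0
    let g : Z →ₗ[ℝ] ℝ := f.toLinearMap.comp Z.subtype
    let Z' : Submodule ℝ X := (LinearMap.ker g).map Z.subtype
    have hZ'fin : finrank ℝ Z' = finrank ℝ (LinearMap.ker g) :=
      fss_finrank_map _ Z.subtype_injective _
    have hZ'Z : Z' ≤ Z := Submodule.map_subtype_le _ _
    have hZ'f : ∀ x ∈ Z', f x = 0 := by
      rintro x ⟨y, hy, rfl⟩
      exact hy
    have hrn := LinearMap.finrank_range_add_finrank_ker g
    have hr : finrank ℝ (LinearMap.range g) ≤ 1 := by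
      simpa using Submodule.finrank_le (LinearMap.range g)
    have hd' : N + 1 ≤ finrank ℝ Z := (le_max_right _ _).trans hd
    have hfd : FiniteDimensional ℝ Z' := Submodule.finiteDimensional_of_le hZ'Z
    obtain ⟨W, hW, hWk, hWb⟩ := hN Z' hfd (by omega)
    have hfdW : FiniteDimensional ℝ W := Submodule.finiteDimensional_of_le hW
    refine ⟨W ⊔ Submodule.span ℝ {z}, ?_, ?_, ?_⟩
    · refine sup_le (hW.trans hZ'Z) ?_
      rw [Submodule.span_singleton_le_iff_mem]
      exact hzZ
    · have hlt : W < W ⊔ Submodule.span ℝ {z} := by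
        refine lt_of_le_of_ne le_sup_left fun h => ?_
        have hzW : z ∈ W := by
          rw [h]
          exact Submodule.mem_sup_right (Submodule.mem_span_singleton_self z)
        have := hZ'f z (hW hzW)
        rw [hfz'] at this
        exact hzpos.ne' this
      have := Submodule.finrank_lt_finrank_of_lt hlt
      omega
    · intro w hw
      obtain ⟨u, hu, v, hv, rfl⟩ := Submodule.mem_sup.mp hw
      obtain ⟨a, rfl⟩ := Submodule.mem_span_singleton.mp hv
      have h1 : f (u + a • z) = a * ‖z‖ := by
        rw [map_add, map_smul, hZ'f u (hW hu), hfz']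
        simp
      have h2 : |a| * ‖z‖ ≤ ‖u + a • z‖ := by
        have := f.le_opNorm (u + a • z)
        rw [h1, hf1, one_mul, Real.norm_eq_abs, abs_mul, abs_norm] at this
        exact this
      have h3 : ‖u‖ ≤ ‖u + a • z‖ + |a| * ‖z‖ := by
        have := norm_sub_le (u + a • z) (a • z)
        rw [add_sub_cancel_right, norm_smul a z, Real.norm_eq_abs] at this
        exact this
      have h4 : ‖A (u + a • z)‖ ≤ ‖A u‖ + |a| * ‖A z‖ := by
        rw [map_add, map_smul]
        refine (norm_add_le _ _).trans ?_
        rw [norm_smul, Real.norm_eq_abs]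
      have h5 := hWb u hu
      have h6 : |a| * ‖A z‖ ≤ |a| * (ε / 3 * ‖z‖) :=
        mul_le_mul_of_nonneg_left hz.le (abs_nonneg a)
      have h7 : ε / 3 * ‖u‖ ≤ ε / 3 * (2 * ‖u + a • z‖) :=
        mul_le_mul_of_nonneg_left (by linarith) (by positivity)
      have h8 : ε / 3 * (|a| * ‖z‖) ≤ ε / 3 * ‖u + a • z‖ :=
        mul_le_mul_of_nonneg_left h2 (by positivity)
      linarith

theorem fss_graph {X Y : Type*} [NormedAddCommGroup X] [NormedSpace ℝ X]
    [NormedAddCommGroup Y] [NormedSpace ℝ Y] (A : X →L[ℝ] Y)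
    (hfss : ∀ ε > (0 : ℝ), ∃ n : ℕ, ∀ Z : Submodule ℝ X,
      (n : Cardinal) ≤ Module.rank ℝ Z → ∃ z ∈ Z, z ≠ 0 ∧ ‖A z‖ < ε * ‖z‖) (k : ℕ)
    (ε : ℝ) (hε : 0 < ε) : ∃ N : ℕ, ∀ K : Submodule ℝ (X × Y),
      K ≤ LinearMap.graph A.toLinearMap → FiniteDimensional ℝ K → N ≤ finrank ℝ K →
      ∃ L ≤ K, k ≤ finrank ℝ L ∧ ∀ p ∈ L, ‖p‖ = 1 → ‖p.2‖ ≤ ε := by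
  obtain ⟨N, hN⟩ := fss_core A hfss k ε hε
  refine ⟨N, fun K hK hfd hd => ?_⟩
  have hKA : ∀ p ∈ K, p.2 = A p.1 := fun p hp => (LinearMap.mem_graph_iff _ _).mp (hK hp)
  let F : X →ₗ[ℝ] X × Y := LinearMap.prod LinearMap.id A.toLinearMap
  have hF : Function.Injective F := fun a b h => congrArg Prod.fst h
  let Z : Submodule ℝ X := K.map (LinearMap.fst ℝ X Y)
  have hKZ : Z.map F = K := by
    ext p
    constructor
    · rintro ⟨_, ⟨q, hq, rfl⟩, rfl⟩
      have : F (LinearMap.fst ℝ X Y q) = q := Prod.ext rfl (hKA q hq).symm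
      rw [this]
      exact hq
    · intro hp
      exact ⟨p.1, ⟨p, hp, rfl⟩, Prod.ext rfl (hKA p hp).symm⟩
  have hZ : finrank ℝ Z = finrank ℝ K := by
    rw [← hKZ]
    exact (fss_finrank_map F hF Z).symm
  obtain ⟨W, hW, hk, hb⟩ := hN Z inferInstance (hZ ▸ hd)
  refine ⟨W.map F, hKZ ▸ Submodule.map_mono hW, ?_, ?_⟩
  · rwa [fss_finrank_map F hF W]
  · rintro _ ⟨w, hw, rfl⟩ h1
    have h2 : ‖w‖ ≤ 1 := h1 ▸ norm_fst_le (F w)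
    calc ‖A w‖ ≤ ε * ‖w‖ := hb w hw
      _ ≤ ε * 1 := mul_le_mul_of_nonneg_left h2 hε.le
      _ = ε := mul_one _

theorem fss_max {X Y : Type*} [NormedAddCommGroup X] [NormedSpace ℝ X]
    [NormedAddCommGroup Y] [NormedSpace ℝ Y] (ε : ℝ)
    (K : Submodule ℝ (X × Y)) : ∃ L ≤ K, (∀ p ∈ L, ‖p‖ = 1 → ‖p.2‖ ≤ ε) ∧
      (FiniteDimensional ℝ K → ∀ L' ≤ K, (∀ p ∈ L', ‖p‖ = 1 → ‖p.2‖ ≤ ε) →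
        finrank ℝ L' ≤ finrank ℝ L) := by
  have hbot : ∀ p ∈ (⊥ : Submodule ℝ (X × Y)), ‖p‖ = 1 → ‖p.2‖ ≤ ε := by
    intro p hp h1
    rw [Submodule.mem_bot] at hp
    simp [hp] at h1
  by_cases hfd : FiniteDimensional ℝ K
  · let S : Set ℕ := {d | ∃ L ≤ K, (∀ p ∈ L, ‖p‖ = 1 → ‖p.2‖ ≤ ε) ∧ finrank ℝ L = d}
    have hne : S.Nonempty := ⟨_, ⊥, bot_le, hbot, rfl⟩
    have hbd : BddAbove S := by
      refine ⟨finrank ℝ K, ?_⟩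
      rintro _ ⟨L, hL, _, rfl⟩
      exact Submodule.finrank_mono hL
    obtain ⟨L, hL, hb, he⟩ := Nat.sSup_mem hne hbd
    exact ⟨L, hL, hb, fun _ L' hL' hb' => he ▸ le_csSup hbd ⟨L', hL', hb', rfl⟩⟩
  · exact ⟨⊥, bot_le, hbot, fun h => absurd h hfd⟩

theorem fss_seq {X Y : Type*} [NormedAddCommGroup X] [NormedSpace ℝ X]
    [NormedAddCommGroup Y] [NormedSpace ℝ Y] (A : X →L[ℝ] Y)
    (hfss : ∀ ε > (0 : ℝ), ∃ n : ℕ, ∀ Z : Submodule ℝ X,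
      (n : Cardinal) ≤ Module.rank ℝ Z → ∃ z ∈ Z, z ≠ 0 ∧ ‖A z‖ < ε * ‖z‖)
    (ε : ℝ) (hε : 0 < ε) (l : Filter ℕ) (K : ℕ → Submodule ℝ (X × Y))
    (hK : ∀ᶠ n in l, K n ≤ LinearMap.graph A.toLinearMap ∧ FiniteDimensional ℝ (K n))
    (ht : Tendsto (fun n => finrank ℝ (K n)) l atTop) :
    ∃ L : ℕ → Submodule ℝ (X × Y), (∀ n, L n ≤ K n) ∧
      Tendsto (fun n => finrank ℝ (L n)) l atTop ∧
      ∀ n, ∀ p ∈ L n, ‖p‖ = 1 → ‖p.2‖ ≤ ε := by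
  choose L hL hb hm using fun n => fss_max ε (K n)
  refine ⟨L, hL, tendsto_atTop.mpr fun k => ?_, hb⟩
  obtain ⟨N, hN⟩ := fss_graph A hfss k ε hε
  filter_upwards [hK, tendsto_atTop.mp ht N] with n hn hd
  obtain ⟨L', hL', hk, hb'⟩ := hN (K n) hn.1 hn.2 hd
  exact hk.trans (hm n hn.2 L' hL' hb')

/-- A finitely strictly singular bounded operator has finitely strictly singular uniform
λ-adjustment `0` with the zero operator; concretely, finite-dimensional subspaces of the
graph with dimensions tending to infinity can be refined (along a subsequence) to
subspaces with dimensions tending to infinity on which every unit vector `(x, Ax)`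
satisfies `‖Ax‖ ≤ η`. -/
theorem stmt18 {X Y : Type*} [NormedAddCommGroup X] [NormedSpace ℝ X] [CompleteSpace X]
    [NormedAddCommGroup Y] [NormedSpace ℝ Y] [CompleteSpace Y]
    (A : X →L[ℝ] Y)
    (hfss : ∀ ε > (0 : ℝ), ∃ n : ℕ, ∀ Z : Submodule ℝ X,
      (n : Cardinal) ≤ Module.rank ℝ Z → ∃ z ∈ Z, z ≠ 0 ∧ ‖A z‖ < ε * ‖z‖) :
    (∀ η > (0 : ℝ), ∀ K : ℕ → Submodule ℝ (X × Y),
      (∀ n, K n ≤ LinearMap.graph A.toLinearMap ∧ FiniteDimensional ℝ (K n)) →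
      Tendsto (fun n => finrank ℝ (K n)) atTop atTop →
      ∃ φ : ℕ → ℕ, StrictMono φ ∧ ∃ L : ℕ → Submodule ℝ (X × Y),
        (∀ n, L n ≤ K (φ n)) ∧
        Tendsto (fun n => finrank ℝ (L n)) atTop atTop ∧
        ∀ n, ∀ p ∈ L n, ‖p‖ = 1 → ‖p.2‖ ≤ η) ∧
    fssLambdaAdj Set.univ (fun _ => LinearMap.graph A.toLinearMap)
      (fun _ => LinearMap.graph (0 : X →ₗ[ℝ] Y)) = 0 := by
  refine ⟨?_, ?_⟩
  · intro η hη K hK ht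
    obtain ⟨L, hL, hLt, hb⟩ :=
      fss_seq A hfss η hη atTop K (Filter.Eventually.of_forall hK) ht
    exact ⟨id, strictMono_id, L, hL, hLt, hb⟩
  · refine le_antisymm (le_of_forall_pos_le_add fun lam hlam => ?_)
      (Real.sInf_nonneg fun x hx => hx.1)
    rw [zero_add]
    refine csInf_le ⟨0, fun x hx => hx.1⟩ ⟨hlam.le, ?_⟩
    intro N'' _ hinf K hK ht
    have hev : ∀ᶠ n in atTop ⊓ 𝓟 N'', n ∈ N'' :=
      Filter.mem_inf_of_right (Filter.mem_principal_self N'')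
    obtain ⟨L, hL, hLt, hb⟩ := fss_seq A hfss lam hlam (atTop ⊓ 𝓟 N'') K (hev.mono hK) ht
    refine ⟨N'', subset_rfl, hinf, L, fun n _ => hL n, hLt, ?_⟩
    refine csInf_le ⟨0, fun x hx => hx.1⟩ ⟨hlam.le, ?_⟩
    intro η hη M _ hM x hx
    refine ⟨M, subset_rfl, hM, fun n => ((x n).1, 0), fun n _ => ?_, 0, ?_⟩
    · simp [LinearMap.mem_graph_iff]
    · have hne : (atTop ⊓ 𝓟 M : Filter ℕ).NeBot := by
        rw [← Filter.frequently_mem_iff_neBot]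
        exact Nat.frequently_atTop_iff_infinite.mpr hM
      have hevM : ∀ᶠ n in atTop ⊓ 𝓟 M, n ∈ M :=
        Filter.mem_inf_of_right (Filter.mem_principal_self M)
      refine Filter.limsup_le_of_le ?_ ?_
      · refine Filter.IsBoundedUnder.isCoboundedUnder_le ⟨0, ?_⟩
        rw [Filter.eventually_map]
        exact Filter.Eventually.of_forall fun n => norm_nonneg _
      · filter_upwards [hevM] with n hn
        have h1 := hb n (x n) (hx n hn).1 (hx n hn).2
        have h2 : x n - ((x n).1, (0 : Y)) - 0 = (0, (x n).2) := by
          ext <;> simp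
        rw [h2, Prod.norm_mk, norm_zero, max_eq_right (norm_nonneg _)]
        linarith
end
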